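/- Let F be a maximal s-collection in 2^[n]. Suppose that for some i < j < k in [n] and some X ⊆ [n] ∖ {i, j, k}, F contains the six sets X, X∪{i}, X∪{k}, X∪{i,j}, X∪{j,k}, X∪{i,j,k}, and contains one set B of the pair {X∪{j}, X∪{i,k}}. Then (F ∖ {B}) ∪ {B′}, where B′ is the other set of the pair {X∪{j}, X∪{i,k}}, is also a maximal s-collection in 2^[n]. -/

import Mathlib

open Finset

/-- max of a finite set of naturals, with the convention `max0 ∅ = 0`. -/
def max0 (A : Finset ℕ) : ℕ := if h : A.Nonempty then A.max' h else 0

/-- min of a finite set of naturals, with the convention `min0 ∅ = 0`. -/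
def min0 (A : Finset ℕ) : ℕ := if h : A.Nonempty then A.min' h else 0

/-- `A < B` : global dominating, i.e. `max A < min B` (with `min ∅ = max ∅ = 0`). -/
def SetLT (A B : Finset ℕ) : Prop := max0 A < min0 B

/-- `A ⋖ B` : global dominating after cancelations, i.e. `(A − B) < (B − A)`. -/
def LessDot (A B : Finset ℕ) : Prop := SetLT (A \ B) (B \ A)

/-- `A ▷ B` (splitting): `A − B ≠ ∅` and `B − A` is a union of nonempty subsets
`B′, B″` with `B′ < (A − B) < B″`. -/
def Splits (A B : Finset ℕ) : Prop :=
  (A \ B).Nonempty ∧ ∃ B' B'' : Finset ℕ, B'.Nonempty ∧ B''.Nonempty ∧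
    B' ∪ B'' = B \ A ∧ SetLT B' (A \ B) ∧ SetLT (A \ B) B''

/-- `A` and `B` are strongly separated. -/
def StronglySep (A B : Finset ℕ) : Prop := LessDot A B ∨ LessDot B A ∨ A = B

/-- `A` and `B` are weakly separated. -/
def WeaklySep (A B : Finset ℕ) : Prop :=
  StronglySep A B ∨ (Splits A B ∧ B.card ≤ A.card) ∨ (Splits B A ∧ A.card ≤ B.card)

/-- a w-collection: members are pairwise weakly separated. -/
def IsWColl (F : Finset (Finset ℕ)) : Prop := ∀ A ∈ F, ∀ B ∈ F, WeaklySep A B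

/-- a maximal w-collection in the domain `D`. -/
def IsMaxWColl (D : Set (Finset ℕ)) (F : Finset (Finset ℕ)) : Prop :=
  ↑F ⊆ D ∧ IsWColl F ∧
    ∀ G : Finset (Finset ℕ), ↑G ⊆ D → IsWColl G → F ⊆ G → F = G

/-- the domain `D` is w-pure: all maximal w-collections in `D` have the same cardinality. -/
def WPure (D : Set (Finset ℕ)) : Prop :=
  ∀ F G : Finset (Finset ℕ), IsMaxWColl D F → IsMaxWColl D G → F.card = G.card

/-- an s-collection: members are pairwise strongly separated. -/
def IsSColl (F : Finset (Finset ℕ)) : Prop := ∀ A ∈ F, ∀ B ∈ F, StronglySep A B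

/-- a maximal s-collection in the domain `D`. -/
def IsMaxSColl (D : Set (Finset ℕ)) (F : Finset (Finset ℕ)) : Prop :=
  ↑F ⊆ D ∧ IsSColl F ∧
    ∀ G : Finset (Finset ℕ), ↑G ⊆ D → IsSColl G → F ⊆ G → F = G

/-- the domain `D` is s-pure: all maximal s-collections in `D` have the same cardinality. -/
def SPure (D : Set (Finset ℕ)) : Prop :=
  ∀ F G : Finset (Finset ℕ), IsMaxSColl D F → IsMaxSColl D G → F.card = G.card

theorem setLT_iff {A B : Finset ℕ} (hB : ∀ b ∈ B, 0 < b) :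
    SetLT A B ↔ B.Nonempty ∧ ∀ a ∈ A, ∀ b ∈ B, a < b := by
  unfold SetLT max0 min0
  rcases B.eq_empty_or_nonempty with rfl | hBne
  · simp
  · rcases A.eq_empty_or_nonempty with rfl | hAne
    · simpa [hBne] using hB _ (B.min'_mem hBne)
    · simp only [hAne, hBne, dif_pos, true_and]
      refine ⟨fun h a ha b hb => (A.le_max' a ha).trans_lt (h.trans_le (B.min'_le b hb)),
        fun h => h _ (A.max'_mem hAne) _ (B.min'_mem hBne)⟩

/-- Strong separation, spelled out elementwise. -/
def ElemSep (A B : Finset ℕ) : Prop :=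
  (∀ a b, a ∈ A → a ∉ B → b ∈ B → b ∉ A → a < b) ∨
    (∀ a b, a ∈ A → a ∉ B → b ∈ B → b ∉ A → b < a)

theorem stronglySep_iff_elemSep {A B : Finset ℕ} (hA : ∀ a ∈ A, 0 < a) (hB : ∀ b ∈ B, 0 < b) :
    StronglySep A B ↔ ElemSep A B := by
  unfold StronglySep LessDot ElemSep
  rw [setLT_iff (fun b hb => hB b (mem_sdiff.1 hb).1),
    setLT_iff (fun a ha => hA a (mem_sdiff.1 ha).1)]
  simp only [mem_sdiff]
  constructor
  · rintro (⟨-, h⟩ | ⟨-, h⟩ | rfl)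
    · exact Or.inl fun a b h1 h2 h3 h4 => h a ⟨h1, h2⟩ b ⟨h3, h4⟩
    · exact Or.inr fun a b h1 h2 h3 h4 => h b ⟨h3, h4⟩ a ⟨h1, h2⟩
    · exact Or.inl fun a b h1 h2 => absurd h1 h2
  · intro h
    by_cases hAB : (A \ B).Nonempty
    · by_cases hBA : (B \ A).Nonempty
      · rcases h with h | h
        · exact Or.inl ⟨hBA, fun a ha b hb => h a b ha.1 ha.2 hb.1 hb.2⟩
        · exact Or.inr (Or.inl ⟨hAB, fun b hb a ha => h a b ha.1 ha.2 hb.1 hb.2⟩)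
      · refine Or.inr (Or.inl ⟨hAB, fun b hb => absurd ⟨b, mem_sdiff.2 hb⟩ hBA⟩)
    · by_cases hBA : (B \ A).Nonempty
      · exact Or.inl ⟨hBA, fun a ha => absurd ⟨a, mem_sdiff.2 ha⟩ hAB⟩
      · rw [not_nonempty_iff_eq_empty, sdiff_eq_empty_iff_subset] at hAB hBA
        exact Or.inr (Or.inr (hAB.antisymm hBA))

theorem StronglySep.symm {A B : Finset ℕ} (h : StronglySep A B) : StronglySep B A := by
  rcases h with h | h | h
  exacts [Or.inr (Or.inl h), Or.inl h, Or.inr (Or.inr h.symm)]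

theorem StronglySep.refl (A : Finset ℕ) : StronglySep A A := Or.inr (Or.inr rfl)

section Flip

variable {i j k : ℕ} {X Y : Finset ℕ}

theorem elemSep_insert_middle (hij : i < j) (hjk : j < k)
    (hiX : i ∉ X) (hjX : j ∉ X) (hkX : k ∉ X)
    (h0 : ElemSep Y X) (h1 : ElemSep Y (insert i X))
    (h3 : ElemSep Y (insert i (insert j X))) (h4 : ElemSep Y (insert j (insert k X)))
    (hne : Y ≠ insert i (insert k X)) : ElemSep Y (insert j X) := by
  unfold ElemSep at *
  simp only [mem_insert] at *
  by_cases hi : i ∈ Y <;> by_cases hj : j ∈ Y <;> by_cases hk : k ∈ Y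
  · clear h1 h3 h4
    grind
  · clear h1 h3 h4
    grind
  · exfalso
    apply hne
    have hD : ∀ a ∈ Y, a ∉ X → a = i ∨ a = k := by
      clear h0 h1
      grind
    have hE : ∀ a ∈ X, a ∈ Y := by
      clear h1
      grind
    ext a
    grind
  · clear h0 h1 h3
    grind
  · clear h1 h3 h4
    grind
  · clear h0 h3 h4
    grind
  · clear h0 h1 h4
    grind
  · clear h0 h1 h4
    grind

theorem elemSep_insert_outer (hij : i < j) (hjk : j < k)
    (hjX : j ∉ X)
    (h0 : ElemSep Y X) (h1 : ElemSep Y (insert i X)) (h2 : ElemSep Y (insert k X))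
    (h5 : ElemSep Y (insert i (insert j (insert k X))))
    (hne : Y ≠ insert j X) : ElemSep Y (insert i (insert k X)) := by
  unfold ElemSep at *
  simp only [mem_insert] at *
  by_cases hi : i ∈ Y <;> by_cases hj : j ∈ Y <;> by_cases hk : k ∈ Y
  · clear h1 h2 h5
    grind
  · clear h0 h1 h5
    grind
  · clear h1 h2 h5
    grind
  · clear h0 h1 h2
    grind
  · clear h0 h2 h5
    grind
  · exfalso
    apply hne
    have hE : ∀ a ∈ X, a ∈ Y := by
      clear h0 h5
      grind
    have hD : ∀ a ∈ Y, a ∉ X → a = j := by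
      clear h0
      grind
    ext a
    grind
  · clear h0 h1 h2
    grind
  · clear h0 h1 h2
    grind

theorem not_elemSep_flip (hij : i < j) (hjk : j < k)
    (hiX : i ∉ X) (hjX : j ∉ X) (hkX : k ∉ X) :
    ¬ ElemSep (insert j X) (insert i (insert k X)) := by
  unfold ElemSep
  simp only [mem_insert]
  rintro (h | h)
  · exact hij.not_gt <| h j i (by simp) (by simp [hjX, hij.ne', hjk.ne]) (by simp)
      (by simp [hiX, hij.ne])
  · exact hjk.not_gt <| h j k (by simp) (by simp [hjX, hij.ne', hjk.ne]) (by simp)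
      (by simp [hkX, hjk.ne'])

/-- The six sets whose presence allows exchanging `X ∪ {j}` and `X ∪ {i, k}`. -/
def flipWitnesses (i j k : ℕ) (X : Finset ℕ) : Finset (Finset ℕ) :=
  {X, insert i X, insert k X, insert i (insert j X), insert j (insert k X),
    insert i (insert j (insert k X))}

theorem flipWitnesses_disjoint (hij : i < j) (hjk : j < k)
    (hiX : i ∉ X) (hjX : j ∉ X) (hkX : k ∉ X) :
    insert j X ∉ flipWitnesses i j k X ∧ insert i (insert k X) ∉ flipWitnesses i j k X := by
  have h : ∀ Z ∈ flipWitnesses i j k X,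
      (i ∈ Z → k ∈ Z → j ∈ Z) ∧ (j ∈ Z → i ∈ Z ∨ k ∈ Z) := by
    intro Z hZ
    simp only [flipWitnesses, mem_insert, mem_singleton] at hZ
    rcases hZ with rfl | rfl | rfl | rfl | rfl | rfl <;>
      simp [hiX, hjX, hkX, hij.ne, hjk.ne, hij.ne', hjk.ne', (hij.trans hjk).ne,
        (hij.trans hjk).ne']
  constructor
  · intro hZ
    simpa [hiX, hkX, hij.ne, hjk.ne'] using (h _ hZ).2
  · intro hZ
    simpa [hjX, hij.ne', hjk.ne] using (h _ hZ).1

end Flip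

/-- a strong flip ("in the presence of six witnesses") applied to
a maximal s-collection in `2^[n]` yields a maximal s-collection in `2^[n]`. -/
theorem strong_flip_max_s_collection (n : ℕ) (hn : 1 ≤ n) (F : Finset (Finset ℕ))
    (hF : IsMaxSColl {Y : Finset ℕ | Y ⊆ Finset.Icc 1 n} F)
    (i j k : ℕ) (hi : i ∈ Finset.Icc 1 n) (hj : j ∈ Finset.Icc 1 n)
    (hk : k ∈ Finset.Icc 1 n) (hij : i < j) (hjk : j < k)
    (X : Finset ℕ) (hX : X ⊆ Finset.Icc 1 n)
    (hiX : i ∉ X) (hjX : j ∉ X) (hkX : k ∉ X)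
    (h0 : X ∈ F) (h1 : insert i X ∈ F) (h2 : insert k X ∈ F)
    (h3 : insert i (insert j X) ∈ F) (h4 : insert j (insert k X) ∈ F)
    (h5 : insert i (insert j (insert k X)) ∈ F)
    (B B' : Finset ℕ)
    (hBB' : (B = insert j X ∧ B' = insert i (insert k X)) ∨
            (B = insert i (insert k X) ∧ B' = insert j X))
    (hB : B ∈ F) :
    IsMaxSColl {Y : Finset ℕ | Y ⊆ Finset.Icc 1 n} (insert B' (F.erase B)) := by
  set D : Set (Finset ℕ) := {Y : Finset ℕ | Y ⊆ Finset.Icc 1 n} with hD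
  have pos : ∀ Y ∈ D, ∀ a ∈ Y, 0 < a := fun Y hY a ha => (mem_Icc.1 (hY ha)).1
  have sepIff : ∀ Y ∈ D, ∀ Z ∈ D, (StronglySep Y Z ↔ ElemSep Y Z) := fun Y hY Z hZ =>
    stronglySep_iff_elemSep (pos Y hY) (pos Z hZ)
  obtain ⟨hFD, hFS, hFmax⟩ := hF
  have hjD : insert j X ∈ D := insert_subset hj hX
  have hikD : insert i (insert k X) ∈ D := insert_subset hi (insert_subset hk hX)
  have hBD : B ∈ D := hFD hB
  have hB'D : B' ∈ D := by rcases hBB' with ⟨-, rfl⟩ | ⟨-, rfl⟩ <;> assumption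
  have hnsep : ¬ StronglySep B B' := by
    have := not_elemSep_flip hij hjk hiX hjX hkX
    rw [← sepIff _ hjD _ hikD] at this
    rcases hBB' with ⟨rfl, rfl⟩ | ⟨rfl, rfl⟩
    exacts [this, fun h => this h.symm]
  have hne : B ≠ B' := fun h => hnsep (Or.inr (Or.inr h))
  set W := flipWitnesses i j k X with hW
  have hWF : W ⊆ F := by
    intro Z hZ
    simp only [hW, flipWitnesses, mem_insert, mem_singleton] at hZ
    rcases hZ with rfl | rfl | rfl | rfl | rfl | rfl <;> assumption
  have key : ∀ Y ∈ D, (∀ Z ∈ W, StronglySep Y Z) →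
      (Y ≠ insert i (insert k X) → StronglySep Y (insert j X)) ∧
      (Y ≠ insert j X → StronglySep Y (insert i (insert k X))) := by
    intro Y hY h
    have h' : ∀ Z ∈ W, ElemSep Y Z := fun Z hZ =>
      (sepIff Y hY Z (hFD (hWF hZ))).1 (h Z hZ)
    rw [sepIff Y hY _ hjD, sepIff Y hY _ hikD]
    exact ⟨elemSep_insert_middle hij hjk hiX hjX hkX (h' _ (by simp [hW, flipWitnesses])) (h' _ (by simp [hW, flipWitnesses]))
        (h' _ (by simp [hW, flipWitnesses])) (h' _ (by simp [hW, flipWitnesses])),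
      elemSep_insert_outer hij hjk hjX (h' _ (by simp [hW, flipWitnesses])) (h' _ (by simp [hW, flipWitnesses]))
        (h' _ (by simp [hW, flipWitnesses])) (h' _ (by simp [hW, flipWitnesses]))⟩
  have keyB : ∀ Y ∈ D, (∀ Z ∈ W, StronglySep Y Z) →
      (Y ≠ B' → StronglySep Y B) ∧ (Y ≠ B → StronglySep Y B') := by
    intro Y hY h
    rcases hBB' with ⟨rfl, rfl⟩ | ⟨rfl, rfl⟩
    exacts [key Y hY h, (key Y hY h).symm]
  have hWB : B ∉ W := by
    have := flipWitnesses_disjoint hij hjk hiX hjX hkX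
    rcases hBB' with ⟨rfl, -⟩ | ⟨rfl, -⟩
    exacts [this.1, this.2]
  have exchange : ∀ (G : Finset (Finset ℕ)) (C C' : Finset ℕ), IsSColl G →
      (∀ Y ∈ G, Y ≠ C → StronglySep Y C') → IsSColl (insert C' (G.erase C)) := by
    intro G C C' hG h Y hY Z hZ
    rw [mem_insert, mem_erase] at hY hZ
    rcases hY with rfl | ⟨hYC, hY⟩ <;> rcases hZ with rfl | ⟨hZC, hZ⟩
    exacts [.refl _, (h Z hZ hZC).symm, h Y hY hYC, hG Y hY Z hZ]
  refine ⟨?_, exchange F B B' hFS fun Y hY hYB =>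
    (keyB Y (hFD hY) fun Z hZ => hFS Y hY Z (hWF hZ)).2 hYB, ?_⟩
  · intro Y hY
    rw [mem_coe, mem_insert] at hY
    rcases hY with rfl | hY
    exacts [hB'D, hFD (mem_of_mem_erase hY)]
  · intro G hGD hGS hFG
    have hB'G : B' ∈ G := hFG (mem_insert_self _ _)
    have hBG : B ∉ G := fun h => hnsep (hGS B h B' hB'G)
    have hWG : W ⊆ G := fun Z hZ => hFG <| mem_insert_of_mem <|
      mem_erase.2 ⟨fun h => hWB (h ▸ hZ), hWF hZ⟩
    have hFeq := hFmax (insert B (G.erase B'))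
      (by
        intro Y hY
        rw [mem_coe, mem_insert] at hY
        rcases hY with rfl | hY
        exacts [hBD, hGD (mem_of_mem_erase hY)])
      (exchange G B' B hGS fun Y hY hYB' =>
        (keyB Y (hGD hY) fun Z hZ => hGS Y hY Z (hWG hZ)).1 hYB')
      (by
        intro Y hY
        rw [mem_insert, mem_erase]
        by_cases hYB : Y = B
        · exact Or.inl hYB
        · refine Or.inr ⟨?_, hFG (mem_insert_of_mem (mem_erase.2 ⟨hYB, hY⟩))⟩
          rintro rfl
          exact hnsep (hFS B hB Y hY))
    rw [hFeq, erase_insert (fun h => hBG (mem_of_mem_erase h)), insert_erase hB'G]
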